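/- Let all m facilities have equal capacity k, and let v ∈ [0,1]^m be a percentile vector with v_1 < v_2 < … < v_m and ⌊v_{j+1}(n−1)⌋ − ⌊v_j(n−1)⌋ > 1 for every j ∈ [m−1]. Then the percentile mechanism PM_v is Equilibrium Stable if and only if ⌊v_{j+1}(n−1)⌋ − ⌊v_j(n−1)⌋ ≥ 2k − 1 for every j ∈ [m−1]. -/

import Mathlib

open scoped Classical

noncomputable section

/-- Agent `i'` precedes agent `i` at a facility located at `y`: it is strictly closer,
or equally close with higher priority (smaller index). -/
def Prec {n : ℕ} (x : Fin n → ℝ) (y : ℝ) (i' i : Fin n) : Prop :=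
  |x i' - y| < |x i - y| ∨ (|x i' - y| = |x i - y| ∧ i' < i)

/-- Utility of agent `i` in the FCFS game: positions `x`, facility locations `y`,
capacities `k`, strategy profile `s`.  Agent `i` is served by facility `s i` iff fewer
than `k (s i)` agents selecting `s i` precede it. -/
def utility {n m : ℕ} (x : Fin n → ℝ) (y : Fin m → ℝ) (k : Fin m → ℕ)
    (s : Fin n → Fin m) (i : Fin n) : ℝ :=
  if {i' | s i' = s i ∧ Prec x (y (s i)) i' i}.ncard < k (s i)
  then 1 - |x i - y (s i)| else 0

/-- Pure Nash equilibrium of the FCFS game. -/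
def isNE {n m : ℕ} (x : Fin n → ℝ) (y : Fin m → ℝ) (k : Fin m → ℕ)
    (s : Fin n → Fin m) : Prop :=
  ∀ (i : Fin n) (j : Fin m),
    utility x y k (Function.update s i j) i ≤ utility x y k s i

/-- Social welfare of a strategy profile. -/
def SW {n m : ℕ} (x : Fin n → ℝ) (y : Fin m → ℝ) (k : Fin m → ℕ)
    (s : Fin n → Fin m) : ℝ :=
  ∑ i, utility x y k s i

def InUnit {N : ℕ} (x : Fin N → ℝ) : Prop := ∀ i, x i ∈ Set.Icc (0 : ℝ) 1

/-- The `i`-th (0-based) smallest entry of `x` (junk value `0` out of range). -/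
def sortedVal {n : ℕ} (x : Fin n → ℝ) (i : ℕ) : ℝ :=
  if h : i < n then x (Tuple.sort x ⟨i, h⟩) else 0

/-- The 1-based index `⌊(n-1)v⌋ + 1` used by the percentile mechanism. -/
def percIdx (n : ℕ) (v : ℝ) : ℕ := ⌊((n : ℝ) - 1) * v⌋.toNat + 1

/-- The location selected by the percentile `v`: the `(⌊(n-1)v⌋+1)`-th sorted report. -/
def percLoc {n : ℕ} (x : Fin n → ℝ) (v : ℝ) : ℝ :=
  sortedVal x (⌊((n : ℝ) - 1) * v⌋.toNat)

/-- The percentile mechanism induced by the percentile vector `v`. -/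
def PM {n m : ℕ} (v : Fin m → ℝ) : (Fin n → ℝ) → Fin m → ℝ :=
  fun x j => percLoc x (v j)

/-- A mechanism is Equilibrium Stable if on every instance all pure Nash equilibria of the
induced FCFS game yield the same Social Welfare. -/
def EquilibriumStable {n m : ℕ} (k : Fin m → ℕ)
    (M : (Fin n → ℝ) → Fin m → ℝ) : Prop :=
  ∀ x, InUnit x → ∀ s s', isNE x (M x) k s → isNE x (M x) k s' →
    SW x (M x) k s = SW x (M x) k s'

/-- A mechanism is absolutely truthful if no agent can increase its best-response utility
by misreporting, whatever the fixed strategies of the others. -/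
def AbsolutelyTruthful {n m : ℕ} (k : Fin m → ℕ)
    (M : (Fin n → ℝ) → Fin m → ℝ) : Prop :=
  ∀ x, InUnit x → ∀ (i : Fin n) (x' : ℝ), x' ∈ Set.Icc (0 : ℝ) 1 →
    ∀ s : Fin n → Fin m,
      (⨆ si : Fin m, utility x (M (Function.update x i x')) k (Function.update s i si) i) ≤
      (⨆ si : Fin m, utility x (M x) k (Function.update s i si) i)

/-- Optimal Social Welfare over facility locations in `[0,1]^m` and Nash equilibria. -/
def SWopt {n m : ℕ} (k : Fin m → ℕ) (x : Fin n → ℝ) : ℝ :=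
  sSup {w | ∃ y : Fin m → ℝ, InUnit y ∧ ∃ s, isNE x y k s ∧ w = SW x y k s}

/-- Social Welfare achieved by a mechanism (common value over all NE for ES mechanisms). -/
def SWmech {n m : ℕ} (k : Fin m → ℕ) (M : (Fin n → ℝ) → Fin m → ℝ)
    (x : Fin n → ℝ) : ℝ :=
  sSup {w | ∃ s, isNE x (M x) k s ∧ w = SW x (M x) k s}

/-- Approximation ratio of a mechanism. -/
def approxRatio {n m : ℕ} (k : Fin m → ℕ) (M : (Fin n → ℝ) → Fin m → ℝ) : ℝ :=
  sSup {r | ∃ x : Fin n → ℝ, InUnit x ∧ r = SWopt k x / SWmech k M x}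

end

/-! ### Basic facts about the order `Prec` and the game -/

/-- Number of agents selecting `f` that precede `i` there. -/
noncomputable def cnt {n m : ℕ} (x : Fin n → ℝ) (y : Fin m → ℝ) (s : Fin n → Fin m)
    (f : Fin m) (i : Fin n) : ℕ :=
  {i' | s i' = f ∧ Prec x (y f) i' i}.ncard

theorem prec_irrefl {n : ℕ} (x : Fin n → ℝ) (y : ℝ) (i : Fin n) : ¬ Prec x y i i := by
  simp [Prec]

theorem prec_key {n : ℕ} (x : Fin n → ℝ) (y : ℝ) (i' i : Fin n) :
    Prec x y i' i ↔ toLex (|x i' - y|, i') < toLex (|x i - y|, i) := by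
  rw [Prod.Lex.toLex_lt_toLex]; rfl

theorem utility_eq {n m k : ℕ} (x : Fin n → ℝ) (y : Fin m → ℝ) (s : Fin n → Fin m) (i : Fin n) :
    utility x y (fun _ => k) s i = if cnt x y s (s i) i < k then 1 - |x i - y (s i)| else 0 := rfl

theorem utility_update {n m k : ℕ} (x : Fin n → ℝ) (y : Fin m → ℝ) (s : Fin n → Fin m)
    (i : Fin n) (f : Fin m) :
    utility x y (fun _ => k) (Function.update s i f) i =
      if cnt x y s f i < k then 1 - |x i - y f| else 0 := by
  rw [utility_eq]
  have : cnt x y (Function.update s i f) (Function.update s i f i) i = cnt x y s f i := by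
    unfold cnt
    congr 1
    ext i'
    simp only [Function.update_self, Set.mem_ofPred_eq]
    constructor
    · rintro ⟨h1, h2⟩
      have : i' ≠ i := by rintro rfl; exact prec_irrefl _ _ _ h2
      rw [Function.update_of_ne this] at h1
      exact ⟨h1, h2⟩
    · rintro ⟨h1, h2⟩
      have : i' ≠ i := by rintro rfl; exact prec_irrefl _ _ _ h2
      rw [Function.update_of_ne this]
      exact ⟨h1, h2⟩
  rw [this]; simp

/-- The agents served by facility `j`. -/
noncomputable def Sv {n m : ℕ} (k : ℕ) (x : Fin n → ℝ) (y : Fin m → ℝ) (s : Fin n → Fin m)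
    (j : Fin m) : Finset (Fin n) :=
  Finset.univ.filter fun i => s i = j ∧ cnt x y s j i < k

theorem mem_Sv {n m k : ℕ} {x : Fin n → ℝ} {y : Fin m → ℝ} {s : Fin n → Fin m}
    {j : Fin m} {i : Fin n} : i ∈ Sv k x y s j ↔ s i = j ∧ cnt x y s j i < k := by
  simp [Sv]

theorem Sv_card_le {n m k : ℕ} (x : Fin n → ℝ) (y : Fin m → ℝ) (s : Fin n → Fin m)
    (j : Fin m) : (Sv k x y s j).card ≤ k := by
  by_cases hne : (Sv k x y s j).Nonempty
  · obtain ⟨a, ha, hmax⟩ := Finset.exists_max_image (Sv k x y s j)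
      (fun i => toLex (|x i - y j|, i)) hne
    have hcnt := (mem_Sv.1 ha).2
    have hsub : (((Sv k x y s j).erase a : Finset (Fin n)) : Set (Fin n)) ⊆
        {i' | s i' = j ∧ Prec x (y j) i' a} := by
      intro i hi
      have hi' := Finset.mem_erase.1 (Finset.mem_coe.1 hi)
      refine ⟨(mem_Sv.1 hi'.2).1, ?_⟩
      rw [prec_key]
      refine lt_of_le_of_ne (hmax i hi'.2) ?_
      intro h
      have := congrArg (fun z => (ofLex z).2) h
      exact hi'.1 this
    have h1 := Set.ncard_le_ncard hsub (Set.toFinite _)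
    rw [Set.ncard_coe_finset, Finset.card_erase_of_mem ha] at h1
    unfold cnt at hcnt
    omega
  · rw [Finset.not_nonempty_iff_eq_empty] at hne
    simp [hne]

theorem Sv_full {n m k : ℕ} (x : Fin n → ℝ) (y : Fin m → ℝ) (s : Fin n → Fin m)
    (j : Fin m) (i : Fin n) (h : k ≤ cnt x y s j i) :
    k ≤ ((Sv k x y s j).filter fun i' => |x i' - y j| ≤ |x i - y j|).card := by
  have hprec : ∀ a b : Fin n, Prec x (y j) a b → |x a - y j| ≤ |x b - y j| := by
    intro a b hab
    rcases hab with h | h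
    · exact h.le
    · exact h.1.le
  -- the first agent `a` with `k ≤ cnt`
  obtain ⟨a, ha, hmin⟩ := Finset.exists_min_image
    (Finset.univ.filter fun a => k ≤ cnt x y s j a)
      (fun i => toLex (|x i - y j|, i)) ⟨i, by simp [h]⟩
  have hai : |x a - y j| ≤ |x i - y j| := by
    have := hmin i (by simp [h])
    rcases Prod.Lex.toLex_le_toLex.1 this with h | h
    · exact h.le
    · exact h.1.le
  have hcnt : k ≤ cnt x y s j a := by simpa using ha
  refine hcnt.trans ?_
  unfold cnt
  rw [← Set.ncard_coe_finset]
  refine Set.ncard_le_ncard ?_ (Set.toFinite _)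
  rintro b ⟨hb1, hb2⟩
  rw [Finset.mem_coe, Finset.mem_filter, mem_Sv]
  refine ⟨⟨hb1, ?_⟩, (hprec _ _ hb2).trans hai⟩
  by_contra hcon
  push Not at hcon
  have h1 := hmin b (by simp [hcon])
  rw [prec_key] at hb2
  exact absurd hb2 (not_lt.2 h1)

/-- What Nash equilibrium gives. -/
theorem ne_dich {n m k : ℕ} {x : Fin n → ℝ} {y : Fin m → ℝ} {s : Fin n → Fin m}
    (hne : isNE x y (fun _ => k) s) (i : Fin n) (j : Fin m) (hd : |x i - y j| < 1) :
    (i ∈ Sv k x y s (s i) ∧ |x i - y (s i)| ≤ |x i - y j|) ∨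
      k ≤ ((Sv k x y s j).filter fun i' => |x i' - y j| ≤ |x i - y j|).card := by
  by_cases hc : cnt x y s j i < k
  · left
    have h := hne i j
    rw [utility_update, utility_eq, if_pos hc] at h
    split_ifs at h with h2
    · exact ⟨mem_Sv.2 ⟨rfl, h2⟩, by linarith⟩
    · linarith
  · right
    exact Sv_full x y s j i (not_lt.1 hc)

/-- Being in the block of facility `j` w.r.t. the sorting `σ`. -/
def inG {n m : ℕ} (k : ℕ) (p : Fin m → ℕ) (σ : Equiv.Perm (Fin n)) (i : Fin n) (j : Fin m) : Prop :=
  (σ.symm i : ℕ) < p j + k ∧ p j < (σ.symm i : ℕ) + k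

/-- Overlap of the assignment with the blocks. -/
noncomputable def Phi {n m : ℕ} (k : ℕ) (p : Fin m → ℕ) (x : Fin n → ℝ) (y : Fin m → ℝ)
    (s : Fin n → Fin m) (σ : Equiv.Perm (Fin n)) : ℕ :=
  (Finset.univ.filter fun i => i ∈ Sv k x y s (s i) ∧ inG k p σ i (s i)).card

theorem exists_max_sort {n m : ℕ} (k : ℕ) (p : Fin m → ℕ) (x : Fin n → ℝ) (y : Fin m → ℝ)
    (s : Fin n → Fin m) : ∃ σ : Equiv.Perm (Fin n), Monotone (x ∘ σ) ∧
      ∀ τ : Equiv.Perm (Fin n), Monotone (x ∘ τ) → Phi k p x y s τ ≤ Phi k p x y s σ := by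
  obtain ⟨σ, h1, h2⟩ := Finset.exists_max_image
    (Finset.univ.filter fun σ : Equiv.Perm (Fin n) => Monotone (x ∘ σ)) (Phi k p x y s)
    ⟨Tuple.sort x, by simp [Tuple.monotone_sort]⟩
  exact ⟨σ, by simpa using h1, fun τ hτ => h2 τ (by simp [hτ])⟩

/-- Interval of positions gives `k` agents. -/
theorem card_positions {n : ℕ} (σ : Equiv.Perm (Fin n)) (a k : ℕ) (h : a + k ≤ n) :
    (Finset.univ.filter fun i : Fin n => a ≤ (σ.symm i : ℕ) ∧ (σ.symm i : ℕ) < a + k).card = k := by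
  have : (Finset.univ.filter fun i : Fin n => a ≤ (σ.symm i : ℕ) ∧ (σ.symm i : ℕ) < a + k) =
      (Finset.univ : Finset (Fin k)).image (fun t : Fin k => σ ⟨a + (t : ℕ), by omega⟩) := by
    ext i
    simp only [Finset.mem_filter, Finset.mem_univ, true_and, Finset.mem_image]
    constructor
    · rintro ⟨h1, h2⟩
      refine ⟨⟨(σ.symm i : ℕ) - a, by omega⟩, ?_⟩
      rw [← Equiv.eq_symm_apply]
      ext
      simp; omega
    · rintro ⟨t, rfl⟩
      simp
  rw [this, Finset.card_image_of_injective, Finset.card_univ, Fintype.card_fin]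
  intro t t' h
  simp at h
  exact Fin.ext h

theorem block_served {n m k : ℕ} (hk : 0 < k) {x : Fin n → ℝ} {y : Fin m → ℝ} {s : Fin n → Fin m}
    (hne : isNE x y (fun _ => k) s) (p : Fin m → ℕ) (hp : ∀ j, p j < n)
    (hgap : ∀ j j', j < j' → p j + (2 * k - 1) ≤ p j')
    (σ : Equiv.Perm (Fin n)) (hσ : Monotone (x ∘ σ))
    (hy : ∀ j, y j = x (σ ⟨p j, hp j⟩))
    (hmax : ∀ τ : Equiv.Perm (Fin n), Monotone (x ∘ τ) → Phi k p x y s τ ≤ Phi k p x y s σ)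
    (i : Fin n) (j : Fin m) (hG : inG k p σ i j) (hd : |x i - y j| < 1) :
    i ∈ Sv k x y s j ∨
      k ≤ ((Sv k x y s j).filter fun i' => |x i' - y j| ≤ |x i - y j|).card := by
  by_contra hcon
  -- minimal violating pair
  obtain ⟨⟨a, f⟩, hviol, hmin⟩ := Finset.exists_min_image
    (Finset.univ.filter fun q : Fin n × Fin m => inG k p σ q.1 q.2 ∧ |x q.1 - y q.2| < 1 ∧
      ¬ (q.1 ∈ Sv k x y s q.2 ∨
        k ≤ ((Sv k x y s q.2).filter fun i' => |x i' - y q.2| ≤ |x q.1 - y q.2|).card))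
    (fun q => |x q.1 - y q.2|) ⟨(i, j), by simpa using ⟨hG, hd, by simpa using hcon⟩⟩
  clear hcon hG hd i j
  rw [Finset.mem_filter] at hviol
  obtain ⟨-, hG, hd, hbad⟩ := hviol
  dsimp only at hG hd hbad hmin
  push Not at hbad
  obtain ⟨hns, hfull⟩ := hbad
  obtain ⟨hserv, hle⟩ := (ne_dich hne a f hd).resolve_right (not_le.2 hfull)
  set g := s a with hg
  have hgf : g ≠ f := by
    intro h; rw [h] at hserv; exact hns hserv
  have hnG : ¬ inG k p σ a g := by
    intro h
    unfold inG at h hG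
    rcases lt_or_gt_of_ne hgf with h1 | h1
    · have := hgap _ _ h1; omega
    · have := hgap _ _ h1; omega
  have hxmono : ∀ u w : Fin n, (σ.symm u : ℕ) ≤ (σ.symm w : ℕ) → x u ≤ x w := by
    intro u w h
    have := hσ (show σ.symm u ≤ σ.symm w from h)
    simpa using this
  have hyr : ∀ u : Fin n, p g ≤ (σ.symm u : ℕ) → y g ≤ x u := by
    intro u h
    rw [hy]; apply hxmono; simpa using h
  have hyl : ∀ u : Fin n, (σ.symm u : ℕ) ≤ p g → x u ≤ y g := by
    intro u h
    rw [hy]; apply hxmono; simpa using h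
  -- find an unserved agent of the block of `g`, weakly closer than `a`, on the same side
  have key : ∃ b : Fin n, inG k p σ b g ∧ b ∉ Sv k x y s g ∧ (x b = x a ∨
      |x b - y g| < |x a - y g|) := by
    have hcard := Sv_card_le (k := k) x y s g
    rcases le_or_gt (p g + k) (σ.symm a : ℕ) with hside | hside
    · have hlt := (σ.symm a).2
      have hc := card_positions σ (p g) k (by omega)
      by_contra hno
      push Not at hno
      have hsub : insert a (Finset.univ.filter fun i : Fin n =>
          p g ≤ (σ.symm i : ℕ) ∧ (σ.symm i : ℕ) < p g + k) ⊆ Sv k x y s g := by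
        intro b hb
        rcases Finset.mem_insert.1 hb with rfl | hb
        · exact hserv
        · rw [Finset.mem_filter] at hb
          obtain ⟨-, hb1, hb2⟩ := hb
          by_contra hbS
          obtain ⟨h1, h2⟩ := hno b ⟨by omega, by omega⟩ hbS
          have hba : x b ≤ x a := hxmono _ _ (by omega)
          have hyb := hyr b hb1
          rw [abs_of_nonneg (by linarith), abs_of_nonneg (by linarith)] at h2
          exact h1 (by linarith)
      have := Finset.card_le_card hsub
      rw [Finset.card_insert_of_notMem, hc] at this
      · omega
      · simp; omega
    · have hside2 : (σ.symm a : ℕ) + k ≤ p g := by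
        unfold inG at hnG; omega
      have hlt := hp g
      have hc := card_positions σ (p g + 1 - k) k (by omega)
      by_contra hno
      push Not at hno
      have hsub : insert a (Finset.univ.filter fun i : Fin n =>
          p g + 1 - k ≤ (σ.symm i : ℕ) ∧ (σ.symm i : ℕ) < p g + 1 - k + k) ⊆ Sv k x y s g := by
        intro b hb
        rcases Finset.mem_insert.1 hb with rfl | hb
        · exact hserv
        · rw [Finset.mem_filter] at hb
          obtain ⟨-, hb1, hb2⟩ := hb
          by_contra hbS
          obtain ⟨h1, h2⟩ := hno b ⟨by omega, by omega⟩ hbS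
          have hba : x a ≤ x b := hxmono _ _ (by omega)
          have hyb := hyl b (by omega)
          rw [abs_of_nonpos (by linarith), abs_of_nonpos (by linarith)] at h2
          exact h1 (by linarith)
      have := Finset.card_le_card hsub
      rw [Finset.card_insert_of_notMem, hc] at this
      · omega
      · simp; omega
  obtain ⟨b, hbG, hbS, hb⟩ := key
  by_cases hclose : |x b - y g| < |x a - y g|
  · -- `(b, g)` would be a smaller violation
    have hnv : ¬ ¬ (b ∈ Sv k x y s g ∨
        k ≤ ((Sv k x y s g).filter fun i' => |x i' - y g| ≤ |x b - y g|).card) := by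
      intro hv
      have := hmin (b, g) (by
        rw [Finset.mem_filter]
        exact ⟨Finset.mem_univ _, hbG, by dsimp only; linarith, hv⟩)
      dsimp only at this
      linarith
    rw [not_not] at hnv
    have h1 := hnv.resolve_left hbS
    have h2 := Sv_card_le (k := k) x y s g
    have h3 : insert a ((Sv k x y s g).filter fun i' => |x i' - y g| ≤ |x b - y g|) ⊆
        Sv k x y s g := by
      intro c hc
      rcases Finset.mem_insert.1 hc with rfl | hc
      · exact hserv
      · exact (Finset.mem_filter.1 hc).1
    have h4 := Finset.card_le_card h3
    rw [Finset.card_insert_of_notMem] at h4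
    · omega
    · simp only [Finset.mem_filter, not_and, not_le]
      intro _; exact hclose
  · have hxeq : x b = x a := hb.resolve_right hclose
    -- swap `a` and `b` in the sorting
    have hab : a ≠ b := by rintro rfl; exact hbS hserv
    set τ : Equiv.Perm (Fin n) := σ.trans (Equiv.swap a b) with hτ
    have hxτ : x ∘ τ = x ∘ σ := by
      funext t
      simp only [hτ, Function.comp, Equiv.trans_apply]
      rcases eq_or_ne (σ t) a with h | h
      · rw [h, Equiv.swap_apply_left, hxeq]
      · rcases eq_or_ne (σ t) b with h' | h'
        · rw [h', Equiv.swap_apply_right, hxeq]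
        · rw [Equiv.swap_apply_of_ne_of_ne h h']
    have hle2 := hmax τ (by rw [hxτ]; exact hσ)
    have hτa : τ.symm a = σ.symm b := by simp [hτ]
    have hτo : ∀ u, u ≠ a → u ≠ b → τ.symm u = σ.symm u := by
      intro u h1 h2
      simp [hτ, Equiv.swap_apply_of_ne_of_ne h1 h2]
    have hlt : Phi k p x y s σ < Phi k p x y s τ := by
      unfold Phi
      apply Finset.card_lt_card
      rw [Finset.ssubset_iff_of_subset]
      · refine ⟨a, ?_, ?_⟩
        · rw [Finset.mem_filter]
          refine ⟨Finset.mem_univ _, hserv, ?_⟩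
          unfold inG at hbG ⊢
          rw [hτa]; exact hbG
        · rw [Finset.mem_filter]
          rintro ⟨-, -, h⟩
          exact hnG h
      · intro u hu
        rw [Finset.mem_filter] at hu ⊢
        obtain ⟨-, hu1, hu2⟩ := hu
        refine ⟨Finset.mem_univ _, hu1, ?_⟩
        have hua : u ≠ a := by
          rintro rfl; exact hnG hu2
        have hub : u ≠ b := by
          rintro rfl
          have hne' : s u ≠ g := by
            intro h; rw [h] at hu1; exact hbS hu1
          unfold inG at hu2 hbG
          rcases lt_or_gt_of_ne hne' with h1 | h1
          · have := hgap _ _ h1; omega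
          · have := hgap _ _ h1; omega
        unfold inG at hu2 ⊢
        rw [hτo u hua hub]; exact hu2
    omega

theorem served_count {n m k : ℕ} (hk : 0 < k) {x : Fin n → ℝ} {y : Fin m → ℝ} {s : Fin n → Fin m}
    (hne : isNE x y (fun _ => k) s) (p : Fin m → ℕ) (hp : ∀ j, p j < n)
    (hgap : ∀ j j', j < j' → p j + (2 * k - 1) ≤ p j')
    (hy : ∀ j, y j = x (Tuple.sort x ⟨p j, hp j⟩)) (j : Fin m) (t : ℝ) (ht : t < 1) :
    ((Sv k x y s j).filter fun i => |x i - y j| ≤ t).card =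
      min k (Finset.univ.filter fun i => |x i - y j| ≤ t).card := by
  apply le_antisymm
  · refine le_min ?_ ?_
    · exact (Finset.card_le_card (Finset.filter_subset _ _)).trans (Sv_card_le x y s j)
    · exact Finset.card_le_card (Finset.filter_subset_filter _ (Finset.subset_univ _))
  obtain ⟨σ, hσ, hmax⟩ := exists_max_sort k p x y s
  have hy' : ∀ j, y j = x (σ ⟨p j, hp j⟩) := by
    intro j
    rw [hy]
    exact congrFun (Tuple.unique_monotone (Tuple.monotone_sort x) hσ) ⟨p j, hp j⟩
  have hB := block_served hk hne p hp hgap σ hσ hy' hmax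
  by_contra hcon
  push Not at hcon
  rw [lt_min_iff] at hcon
  obtain ⟨h1, h2⟩ := hcon
  have hin : ∀ i, inG k p σ i j → |x i - y j| ≤ t →
      i ∈ (Sv k x y s j).filter fun i => |x i - y j| ≤ t := by
    intro i hi hit
    rw [Finset.mem_filter]
    refine ⟨?_, hit⟩
    refine (hB i j hi (by linarith)).resolve_right ?_
    intro hc
    have : ((Sv k x y s j).filter fun i' => |x i' - y j| ≤ |x i - y j|).card ≤
        ((Sv k x y s j).filter fun i => |x i - y j| ≤ t).card := by
      apply Finset.card_le_card
      intro u hu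
      rw [Finset.mem_filter] at hu ⊢
      exact ⟨hu.1, hu.2.trans hit⟩
    omega
  have hxmono : ∀ u w : Fin n, (σ.symm u : ℕ) ≤ (σ.symm w : ℕ) → x u ≤ x w := by
    intro u w h
    have := hσ (show σ.symm u ≤ σ.symm w from h)
    simpa using this
  have hyr : ∀ u : Fin n, p j ≤ (σ.symm u : ℕ) → y j ≤ x u := by
    intro u h
    rw [hy']; apply hxmono; simpa using h
  have hyl : ∀ u : Fin n, (σ.symm u : ℕ) ≤ p j → x u ≤ y j := by
    intro u h
    rw [hy']; apply hxmono; simpa using h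
  have hall : ∀ i, |x i - y j| ≤ t → inG k p σ i j := by
    intro i hi
    by_contra hnG
    rcases le_or_gt (p j + k) (σ.symm i : ℕ) with hside | hside
    · have hlt := (σ.symm i).2
      have hc := card_positions σ (p j) k (by omega)
      have : (Finset.univ.filter fun i : Fin n =>
          p j ≤ (σ.symm i : ℕ) ∧ (σ.symm i : ℕ) < p j + k) ⊆
            (Sv k x y s j).filter fun i => |x i - y j| ≤ t := by
        intro b hb
        rw [Finset.mem_filter] at hb
        obtain ⟨-, hb1, hb2⟩ := hb
        apply hin b ⟨by omega, by omega⟩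
        have hba : x b ≤ x i := hxmono _ _ (by omega)
        have hyb := hyr b hb1
        rw [abs_of_nonneg (by linarith)] at hi ⊢
        linarith
      have := Finset.card_le_card this
      omega
    · have hside2 : (σ.symm i : ℕ) + k ≤ p j := by
        unfold inG at hnG; omega
      have hlt := hp j
      have hc := card_positions σ (p j + 1 - k) k (by omega)
      have : (Finset.univ.filter fun i : Fin n =>
          p j + 1 - k ≤ (σ.symm i : ℕ) ∧ (σ.symm i : ℕ) < p j + 1 - k + k) ⊆
            (Sv k x y s j).filter fun i => |x i - y j| ≤ t := by
        intro b hb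
        rw [Finset.mem_filter] at hb
        obtain ⟨-, hb1, hb2⟩ := hb
        apply hin b ⟨by omega, by omega⟩
        have hba : x i ≤ x b := hxmono _ _ (by omega)
        have hyb := hyl b (by omega)
        rw [abs_of_nonpos (by linarith)] at hi ⊢
        linarith
      have := Finset.card_le_card this
      omega
  have : (Finset.univ.filter fun i => |x i - y j| ≤ t) ⊆
      (Sv k x y s j).filter fun i => |x i - y j| ≤ t := by
    intro i hi
    have hi' : |x i - y j| ≤ t := by simpa using hi
    exact hin i (hall i hi') hi'
  have := Finset.card_le_card this
  omega

/-- Layer-cake formula. -/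
theorem sum_layer {ι : Type*} (S : Finset ι) (d : ι → ℝ) (h0 : ∀ i, 0 ≤ d i) (h1 : ∀ i, d i ≤ 1) :
    ∑ i ∈ S, (1 - d i) = ∫ t in Set.Ico (0 : ℝ) 1, ((S.filter fun i => d i ≤ t).card : ℝ) := by
  have h : ∀ i, (1 - d i) = ∫ t in Set.Ico (0 : ℝ) 1, (Set.Ici (d i)).indicator (fun _ => (1 : ℝ)) t := by
    intro i
    rw [MeasureTheory.setIntegral_indicator measurableSet_Ici]
    have : Set.Ico (0 : ℝ) 1 ∩ Set.Ici (d i) = Set.Ico (d i) 1 := by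
      ext t
      simp only [Set.mem_inter_iff, Set.mem_Ico, Set.mem_Ici]
      constructor
      · rintro ⟨⟨a, b⟩, c⟩; exact ⟨c, b⟩
      · rintro ⟨a, b⟩; exact ⟨⟨(h0 i).trans a, b⟩, a⟩
    rw [this]
    simp [h1 i]
  rw [Finset.sum_congr rfl (fun i _ => h i), ← MeasureTheory.integral_finsetSum]
  · congr 1
    ext t
    rw [Finset.card_filter]
    push_cast
    refine Finset.sum_congr rfl fun i _ => ?_
    simp [Set.indicator_apply]
  · intro i _
    apply MeasureTheory.Integrable.indicator _ measurableSet_Ici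
    simp

theorem SW_eq {n m k : ℕ} (x : Fin n → ℝ) (y : Fin m → ℝ) (s : Fin n → Fin m) :
    SW x y (fun _ => k) s = ∑ j, ∑ i ∈ Sv k x y s j, (1 - |x i - y j|) := by
  unfold SW
  rw [← Finset.sum_fiberwise Finset.univ s]
  refine Finset.sum_congr rfl fun j _ => ?_
  unfold Sv
  rw [← Finset.filter_filter, Finset.sum_filter (p := fun i => cnt x y s j i < k)]
  refine Finset.sum_congr rfl fun i hi => ?_
  have : s i = j := by simpa using hi
  rw [utility_eq, this]

theorem SW_eq_of_ne {n m k : ℕ} (hk : 0 < k) {x : Fin n → ℝ} {y : Fin m → ℝ}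
    (hx : InUnit x) (p : Fin m → ℕ) (hp : ∀ j, p j < n)
    (hgap : ∀ j j', j < j' → p j + (2 * k - 1) ≤ p j')
    (hy : ∀ j, y j = x (Tuple.sort x ⟨p j, hp j⟩)) (s s' : Fin n → Fin m)
    (hs : isNE x y (fun _ => k) s) (hs' : isNE x y (fun _ => k) s') :
    SW x y (fun _ => k) s = SW x y (fun _ => k) s' := by
  rw [SW_eq, SW_eq]
  refine Finset.sum_congr rfl fun j _ => ?_
  have hd1 : ∀ i, |x i - y j| ≤ 1 := by
    intro i
    rw [hy, abs_le]
    have h1 := hx i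
    have h2 := hx (Tuple.sort x ⟨p j, hp j⟩)
    constructor <;> linarith [h1.1, h1.2, h2.1, h2.2]
  rw [sum_layer _ (fun i => |x i - y j|) (fun i => abs_nonneg _) hd1,
    sum_layer _ (fun i => |x i - y j|) (fun i => abs_nonneg _) hd1]
  refine MeasureTheory.setIntegral_congr_fun measurableSet_Ico fun t ht => ?_
  rw [served_count hk hs p hp hgap hy j t ht.2, served_count hk hs' p hp hgap hy j t ht.2]

/-! ### The instance showing necessity -/

theorem ncard_lower {n : ℕ} (S : Set (Fin n)) (a b c d : ℕ) (hb : b ≤ n) (hd : d ≤ n) (hbc : b ≤ c)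
    (h : ∀ i : Fin n, ((a ≤ (i : ℕ) ∧ (i : ℕ) < b) ∨ (c ≤ (i : ℕ) ∧ (i : ℕ) < d)) → i ∈ S) :
    (b - a) + (d - c) ≤ S.ncard := by
  have h1 : (((Finset.Ico a b) ∪ (Finset.Ico c d) : Finset ℕ) : Set ℕ) ⊆ (fun i : Fin n => (i : ℕ)) '' S := by
    intro t ht
    simp only [Finset.coe_union, Finset.coe_Ico, Set.mem_union, Set.mem_Ico] at ht
    exact ⟨⟨t, by omega⟩, h _ ht, rfl⟩
  have h2 := Set.ncard_le_ncard h1 (Set.toFinite _)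
  rw [Set.ncard_coe_finset, Finset.card_union_of_disjoint, Nat.card_Ico, Nat.card_Ico,
    Set.ncard_image_of_injective _ Fin.val_injective] at h2
  · exact h2
  · rw [Finset.disjoint_left]
    intro t ht ht'
    rw [Finset.mem_Ico] at ht ht'
    omega

theorem ncard_upper {n : ℕ} (S : Set (Fin n)) (a b c d : ℕ)
    (h : ∀ i : Fin n, i ∈ S → ((a ≤ (i : ℕ) ∧ (i : ℕ) < b) ∨ (c ≤ (i : ℕ) ∧ (i : ℕ) < d))) :
    S.ncard ≤ (b - a) + (d - c) := by
  have h1 : (fun i : Fin n => (i : ℕ)) '' S ⊆ (((Finset.Ico a b) ∪ (Finset.Ico c d) : Finset ℕ) : Set ℕ) := by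
    rintro _ ⟨i, hi, rfl⟩
    simpa only [Finset.coe_union, Finset.coe_Ico, Set.mem_union, Set.mem_Ico] using h i hi
  have h2 := Set.ncard_le_ncard h1 (Finset.finite_toSet _)
  rw [Set.ncard_coe_finset, Set.ncard_image_of_injective _ Fin.val_injective] at h2
  refine h2.trans ((Finset.card_union_le _ _).trans ?_)
  simp

/-- Positions of the agents. -/
noncomputable def xx (p a q : ℕ) (i : ℕ) : ℝ :=
  if i < p then 0 else if i ≤ p + a then 1 / 5 else if i = p + a + 1 then 3 / 10
  else if i ≤ q then 2 / 5 else 1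

/-- Facility locations. -/
noncomputable def yy (j : ℕ) (f : ℕ) : ℝ :=
  if f < j then 0 else if f = j then 1 / 5 else if f = j + 1 then 2 / 5 else 1

/-- The strategy profile. -/
def ss (k j w p q α μ β : ℕ) (i : ℕ) : ℕ :=
  if i < p then (if i < k * j then i / k else if i < k * j + α then j else j + 1)
  else if i ≤ p + μ then j else if i ≤ q then j + 1
  else if i - (q + 1) < k * w then j + 2 + (i - (q + 1)) / k
  else if i - (q + 1) < k * w + β then j + 1 else j

theorem xx_cases (p a q : ℕ) (h : p + a + 2 ≤ q) (i : ℕ) :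
    (i < p ∧ xx p a q i = 0) ∨ (p ≤ i ∧ i ≤ p + a ∧ xx p a q i = 1 / 5) ∨
    (p + a + 1 ≤ i ∧ i ≤ p + a + 1 ∧ xx p a q i = 3 / 10) ∨ (p + a + 2 ≤ i ∧ i ≤ q ∧ xx p a q i = 2 / 5) ∨
    (q < i ∧ xx p a q i = 1) := by
  unfold xx
  split_ifs <;> simp <;> omega

theorem yy_cases (j f : ℕ) : (f < j ∧ yy j f = 0) ∨ (f = j ∧ yy j f = 1 / 5) ∨
    (f = j + 1 ∧ yy j f = 2 / 5) ∨ (j + 2 ≤ f ∧ yy j f = 1) := by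
  unfold yy
  split_ifs <;> simp <;> omega

theorem ss_lt {k j w p q α μ β : ℕ} (i : ℕ) :
    ss k j w p q α μ β i < j + 2 + w := by
  unfold ss
  split_ifs with h1 h2 h3 h4 h5 h6 h7
  · have := Nat.div_lt_of_lt_mul h2; omega
  · omega
  · omega
  · omega
  · omega
  · have := Nat.div_lt_of_lt_mul h6; omega
  · omega
  · omega

theorem ss_left {k j w p q α μ β : ℕ} (i f : ℕ) (hf : f < j) :
    ss k j w p q α μ β i = f ↔ i < p ∧ i < k * j ∧ i / k = f := by
  unfold ss
  generalize (i - (q + 1)) / k = D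
  split_ifs <;> omega

theorem ss_j {k j w p q α μ β : ℕ} (hμ : p + μ ≤ q) (i : ℕ) :
    ss k j w p q α μ β i = j ↔ (i < p ∧ k * j ≤ i ∧ i < k * j + α) ∨ (p ≤ i ∧ i ≤ p + μ) ∨
      (q + 1 + k * w + β ≤ i) ∧ q + 1 ≤ i ∧ p ≤ i := by
  unfold ss
  generalize (i - (q + 1)) / k = D
  split_ifs with h1 h2 h3 h4 h5 h6 h7
  · have := Nat.div_lt_of_lt_mul h2; omega
  all_goals omega

theorem ss_j1 {k j w p q α μ β : ℕ} (hμ : p + μ ≤ q) (i : ℕ) :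
    ss k j w p q α μ β i = j + 1 ↔ (i < p ∧ k * j + α ≤ i) ∨ (p + μ < i ∧ i ≤ q) ∨
      (q + 1 + k * w ≤ i ∧ i < q + 1 + k * w + β) := by
  unfold ss
  generalize (i - (q + 1)) / k = D
  split_ifs with h1 h2 h3 h4 h5 h6 h7
  · have := Nat.div_lt_of_lt_mul h2; omega
  all_goals omega

theorem ss_right {k j w p q α μ β : ℕ} (hpq : p + μ ≤ q) (i f : ℕ) (hf : j + 2 ≤ f) :
    ss k j w p q α μ β i = f ↔ q + 1 ≤ i ∧ i - (q + 1) < k * w ∧ j + 2 + (i - (q + 1)) / k = f := by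
  unfold ss
  generalize (i - (q + 1)) / k = D
  split_ifs with h1 h2 h3 h4 h5 h6 h7
  · have := Nat.div_lt_of_lt_mul h2; omega
  all_goals omega

/-- Positions as a vector. -/
noncomputable def XX (n p a q : ℕ) : Fin n → ℝ := fun i => xx p a q i

/-- Locations as a vector. -/
noncomputable def YY (j w : ℕ) : Fin (j + 2 + w) → ℝ := fun f => yy j f

/-- Profile as a vector. -/
def SS (n k j w p q α μ β : ℕ) : Fin n → Fin (j + 2 + w) := fun i => ⟨ss k j w p q α μ β i, ss_lt _⟩

/-- Precedence in terms of natural numbers. -/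
def PrecN (p a q j f i' i : ℕ) : Prop :=
  |xx p a q i' - yy j f| < |xx p a q i - yy j f| ∨
    (|xx p a q i' - yy j f| = |xx p a q i - yy j f| ∧ i' < i)

theorem cnt_lower {n k j w p q a α μ β : ℕ} (f : Fin (j + 2 + w)) (i : Fin n) (a' b c d : ℕ)
    (hb : b ≤ n) (hd : d ≤ n) (hbc : b ≤ c)
    (h : ∀ t : ℕ, ((a' ≤ t ∧ t < b) ∨ (c ≤ t ∧ t < d)) →
      ss k j w p q α μ β t = f ∧ PrecN p a q j f t i) :
    (b - a') + (d - c) ≤ cnt (XX n p a q) (YY j w) (SS n k j w p q α μ β) f i := by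
  apply ncard_lower _ _ _ _ _ hb hd hbc
  intro t ht
  obtain ⟨h1, h2⟩ := h t ht
  exact ⟨Fin.ext h1, h2⟩

theorem cnt_upper {n k j w p q a α μ β : ℕ} (f : Fin (j + 2 + w)) (i : Fin n) (a' b c d : ℕ)
    (h : ∀ t : ℕ, ss k j w p q α μ β t = f → PrecN p a q j f t i →
      ((a' ≤ t ∧ t < b) ∨ (c ≤ t ∧ t < d))) :
    cnt (XX n p a q) (YY j w) (SS n k j w p q α μ β) f i ≤ (b - a') + (d - c) := by
  apply ncard_upper
  rintro t ⟨h1, h2⟩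
  exact h t (congrArg Fin.val h1) h2

/-- Standing numerical assumptions and the two regimes. -/
structure Reg (n k j w p q a α μ β : ℕ) : Prop where
  hk : 0 < k
  hq : q < n
  haq : p + a + 2 ≤ q
  hA : a + 2 ≤ k
  hB : q + 1 ≤ p + a + 1 + k
  hμ : μ = a ∨ μ = a + 1
  regime : (n ≤ q + 1 + k * w + β ∧ k * j + α ≤ p ∧ α + μ + 1 = k) ∨
    (p ≤ k * j + α ∧ p + μ + 1 ≤ k * j + k ∧ μ + 1 ≤ k ∧ (q - p - μ) + β = k ∧ q + 1 + k * w + β < n)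

/-- The agents that possibly are not served. -/
def Overflow (n k j w p q α β : ℕ) (i : ℕ) : Prop :=
  (n ≤ q + 1 + k * w + β ∧ ((i < p ∧ k * j + α ≤ i) ∨ q + 1 + k * w ≤ i)) ∨
    (¬ n ≤ q + 1 + k * w + β ∧ q + 1 + k * w + β ≤ i)

theorem served_of_not_overflow {n k j w p q a α μ β : ℕ} (H : Reg n k j w p q a α μ β) (i : Fin n)
    (hi : ¬ Overflow n k j w p q α β i) :
    cnt (XX n p a q) (YY j w) (SS n k j w p q α μ β) (SS n k j w p q α μ β i) i < k := by
  obtain ⟨hk, hq, haq, hA, hB, hμ, hreg⟩ := H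
  have hin := i.2
  unfold Overflow at hi
  set f : Fin (j + 2 + w) := SS n k j w p q α μ β i with hf
  have hfv : ss k j w p q α μ β i = (f : ℕ) := rfl
  have hpμ : p + μ ≤ q := by omega
  rcases yy_cases j f with ⟨h1, hy⟩ | ⟨h1, hy⟩ | ⟨h1, hy⟩ | ⟨h1, hy⟩
  · -- left facility
    obtain ⟨g1, g2, g3⟩ := (ss_left _ _ h1).1 hfv
    have hxi : xx p a q i = 0 := by rcases xx_cases p a q haq i with h | h | h | h | h <;> first | exact h.2 | omega
    have hm := Nat.mod_lt (i : ℕ) hk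
    have hdm := Nat.div_add_mod (i : ℕ) k
    refine lt_of_le_of_lt (cnt_upper f i (k * (f : ℕ)) i 0 0 ?_) (by rw [← g3]; omega)
    intro t ht hprec
    obtain ⟨e1, e2, e3⟩ := (ss_left _ _ h1).1 ht
    have hdm' := Nat.div_add_mod t k
    rw [e3] at hdm'
    unfold PrecN at hprec
    rw [hy, hxi] at hprec
    left
    refine ⟨by omega, ?_⟩
    rcases hprec with h | h
    · simp at h
      exact absurd h (not_lt.2 (abs_nonneg _))
    · exact h.2
  · -- facility j
    rw [h1] at hfv
    rcases (ss_j hpμ _).1 hfv with g | g | g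
    · -- left excess
      have hxi : xx p a q i = 0 := by rcases xx_cases p a q haq i with h | h | h | h | h <;> first | exact h.2 | omega
      refine lt_of_le_of_lt (cnt_upper f i (k * j) i p (p + μ + 1) ?_) (by omega)
      intro t ht hprec
      rw [h1] at ht
      unfold PrecN at hprec
      rw [hy, hxi] at hprec
      rcases xx_cases p a q haq t with h | h | h | h | h
      · rcases hprec with h' | h'
        · rw [h.2] at h'; exact absurd h' (lt_irrefl _)
        · rcases (ss_j hpμ _).1 ht with e | e | e <;> omega
      · omega
      · rcases (ss_j hpμ _).1 ht with e | e | e <;> omega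
      · rcases (ss_j hpμ _).1 ht with e | e | e <;> omega
      · rw [h.2] at hprec
        norm_num [abs_of_nonneg] at hprec
    · -- middle
      refine lt_of_le_of_lt (cnt_upper f i p i 0 0 ?_) (by omega)
      intro t ht hprec
      rw [h1] at ht
      unfold PrecN at hprec
      rw [hy] at hprec
      have htt := (ss_j hpμ _).1 ht
      rcases xx_cases p a q haq i with h | h | h | h | h
      · omega
      · rcases xx_cases p a q haq t with h' | h' | h' | h' | h' <;> simp only [h, h'] at hprec <;>
          norm_num [abs_of_nonneg] at hprec <;> omega
      · rcases xx_cases p a q haq t with h' | h' | h' | h' | h' <;> simp only [h, h'] at hprec <;>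
          norm_num [abs_of_nonneg] at hprec <;> omega
      · omega
      · omega
    · -- right overflow
      omega
  · -- facility j + 1
    rw [h1] at hfv
    rcases (ss_j1 hpμ _).1 hfv with g | g | g
    · omega
    · refine lt_of_le_of_lt (cnt_upper f i (p + a + 2) (q + 1) 0 0 ?_) (by omega)
      intro t ht hprec
      rw [h1] at ht
      unfold PrecN at hprec
      rw [hy] at hprec
      have htt := (ss_j1 hpμ _).1 ht
      rcases xx_cases p a q haq i with h | h | h | h | h
      · omega
      · omega
      · rcases xx_cases p a q haq t with h' | h' | h' | h' | h' <;> simp only [h, h'] at hprec <;>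
          norm_num [abs_of_nonneg] at hprec <;> omega
      · rcases xx_cases p a q haq t with h' | h' | h' | h' | h' <;> simp only [h, h'] at hprec <;>
          norm_num [abs_of_nonneg] at hprec <;> omega
      · omega
    · refine lt_of_le_of_lt (cnt_upper f i (p + μ + 1) (q + 1) (q + 1 + k * w) i ?_) (by omega)
      intro t ht hprec
      rw [h1] at ht
      unfold PrecN at hprec
      rw [hy] at hprec
      have htt := (ss_j1 hpμ _).1 ht
      rcases xx_cases p a q haq i with h | h | h | h | h
      · omega
      · omega
      · omega
      · omega
      · rcases xx_cases p a q haq t with h' | h' | h' | h' | h' <;> simp only [h, h'] at hprec <;>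
          norm_num [abs_of_nonneg] at hprec <;> omega
  · -- right facility
    obtain ⟨g1, g2, g3⟩ := (ss_right (by omega) _ _ h1).1 hfv
    have hxi : xx p a q i = 1 := by rcases xx_cases p a q haq i with h | h | h | h | h <;> first | exact h.2 | omega
    have hm := Nat.mod_lt ((i : ℕ) - (q + 1)) hk
    have hdm := Nat.div_add_mod ((i : ℕ) - (q + 1)) k
    refine lt_of_le_of_lt (cnt_upper f i (q + 1 + k * (((i : ℕ) - (q + 1)) / k)) i 0 0 ?_) (by omega)
    intro t ht hprec
    obtain ⟨e1, e2, e3⟩ := (ss_right (by omega) _ _ h1).1 ht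
    have hdm' := Nat.div_add_mod (t - (q + 1)) k
    have e4 : (t - (q + 1)) / k = ((i : ℕ) - (q + 1)) / k := by omega
    rw [e4] at hdm'
    unfold PrecN at hprec
    rw [hy, hxi] at hprec
    left
    refine ⟨by omega, ?_⟩
    rcases hprec with h | h
    · simp at h
      exact absurd h (not_lt.2 (abs_nonneg _))
    · exact h.2

theorem isNE_of {n m k : ℕ} {x : Fin n → ℝ} {y : Fin m → ℝ} {s : Fin n → Fin m}
    (hd : ∀ i f, |x i - y f| ≤ 1)
    (h : ∀ i f, f ≠ s i → k ≤ cnt x y s f i ∨ 1 ≤ |x i - y f| ∨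
      (cnt x y s (s i) i < k ∧ |x i - y (s i)| ≤ |x i - y f|)) :
    isNE x y (fun _ => k) s := by
  intro i f
  have hu : 0 ≤ utility x y (fun _ => k) s i := by
    rw [utility_eq]
    split_ifs
    · linarith [hd i (s i)]
    · exact le_rfl
  rw [utility_update]
  by_cases hfs : f = s i
  · rw [hfs, utility_eq]
  rcases h i f hfs with h | h | h
  · rw [if_neg (not_lt.2 h)]; exact hu
  · split_ifs
    · linarith
    · exact hu
  · rw [utility_eq, if_pos h.1]
    split_ifs
    · linarith [h.2]
    · linarith [hd i (s i)]

theorem left_full {n k j w p q a α μ β : ℕ} (H : Reg n k j w p q a α μ β)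
    (f : Fin (j + 2 + w)) (hf : (f : ℕ) < j) (i : Fin n) (hi : (i : ℕ) < p) (hki : k * j ≤ i) :
    k ≤ cnt (XX n p a q) (YY j w) (SS n k j w p q α μ β) f i := by
  have hk := H.hk
  have hin := i.2
  have hmul : k * ((f : ℕ) + 1) ≤ k * j := Nat.mul_le_mul_left k hf
  rw [Nat.mul_succ] at hmul
  have := cnt_lower (n := n) (k := k) (p := p) (q := q) (a := a) (α := α) (μ := μ) (β := β) f i
    (k * (f : ℕ)) (k * (f : ℕ) + k) (k * (f : ℕ) + k) 0 (by omega) (by omega) le_rfl ?_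
  · omega
  intro t ht
  refine ⟨(ss_left _ _ hf).2 ⟨by omega, by omega, ?_⟩, ?_⟩
  · rw [Nat.div_eq_iff hk, Nat.mul_comm (f : ℕ) k]
    omega
  · right
    refine ⟨?_, by omega⟩
    unfold xx
    rw [if_pos (by omega), if_pos (by omega)]

theorem right_full {n k j w p q a α μ β : ℕ} (H : Reg n k j w p q a α μ β)
    (f : Fin (j + 2 + w)) (hf : j + 2 ≤ (f : ℕ)) (i : Fin n) (hi : q + 1 + k * w ≤ (i : ℕ)) :
    k ≤ cnt (XX n p a q) (YY j w) (SS n k j w p q α μ β) f i := by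
  obtain ⟨hk, hq, haq, hA, hB, hμ, hreg⟩ := H
  have hin := i.2
  have hf2 := f.2
  obtain ⟨g, hg⟩ := Nat.exists_eq_add_of_le hf
  have hmul : k * (g + 1) ≤ k * w := Nat.mul_le_mul_left k (by omega)
  rw [Nat.mul_succ] at hmul
  have := cnt_lower (n := n) (k := k) (p := p) (q := q) (a := a) (α := α) (μ := μ) (β := β) f i
    (q + 1 + k * g) (q + 1 + k * g + k) (q + 1 + k * g + k) 0 (by omega) (by omega) le_rfl ?_
  · omega
  intro t ht
  refine ⟨(ss_right (by omega) _ _ hf).2 ⟨by omega, by omega, ?_⟩, ?_⟩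
  · have : (t - (q + 1)) / k = g := by
      rw [Nat.div_eq_iff hk, Nat.mul_comm g k]
      omega
    omega
  · right
    refine ⟨?_, by omega⟩
    rcases xx_cases p a q haq i with h | h | h | h | h <;> first | omega | skip
    rcases xx_cases p a q haq t with h' | h' | h' | h' | h' <;> first | omega | skip
    rw [h.2, h'.2]

theorem dist_le_one {n p a q j w : ℕ} (haq : p + a + 2 ≤ q) (i : Fin n) (f : Fin (j + 2 + w)) :
    |XX n p a q i - YY j w f| ≤ 1 := by
  unfold XX YY
  rcases xx_cases p a q haq i with h | h | h | h | h <;>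
    rcases yy_cases j f with ⟨-, h'⟩ | ⟨-, h'⟩ | ⟨-, h'⟩ | ⟨-, h'⟩ <;>
    simp only [h, h'] <;> norm_num [abs_le]

theorem SS_isNE {n k j w p q a α μ β : ℕ} (H : Reg n k j w p q a α μ β) :
    isNE (XX n p a q) (YY j w) (fun _ => k) (SS n k j w p q α μ β) := by
  have haq := H.haq
  refine isNE_of (dist_le_one haq) ?_
  intro i f hfs
  have hserv := served_of_not_overflow H i
  have hlf := left_full H f
  have hrf := right_full H f
  obtain ⟨hk, hq, haq, hA, hB, hμ, hreg⟩ := H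
  have hin := i.2
  have hpμ : p + μ ≤ q := by omega
  set g : Fin (j + 2 + w) := SS n k j w p q α μ β i with hg
  have hgv : ss k j w p q α μ β i = (g : ℕ) := rfl
  have hfg : (f : ℕ) ≠ g := fun h => hfs (Fin.ext h)
  have hY : ∀ f, YY j w f = yy j f := fun _ => rfl
  have hX : XX n p a q i = xx p a q i := rfl
  by_cases hov : Overflow n k j w p q α β i
  · rcases yy_cases j f with ⟨h1, hy⟩ | ⟨h1, hy⟩ | ⟨h1, hy⟩ | ⟨h1, hy⟩
    · -- left facility
      rcases lt_or_ge (i : ℕ) p with hip | hip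
      · left
        apply hlf h1 i hip
        unfold Overflow at hov; omega
      · right; left
        rw [hX, hY, hy]
        unfold Overflow at hov
        rcases xx_cases p a q haq i with h | h | h | h | h <;> first | omega | skip
        rw [h.2]; norm_num
    · -- facility j
      have hns : ss k j w p q α μ β i ≠ j := by rw [hgv]; omega
      rw [Ne, ss_j hpμ] at hns
      unfold Overflow at hov
      have hr : k * j + α ≤ p ∧ α + μ + 1 = k := by omega
      left
      have := cnt_lower (n := n) (k := k) (p := p) (q := q) (a := a) (α := α) (μ := μ) (β := β) f i
        (k * j) (k * j + α) p (p + μ + 1) (by omega) (by omega) (by omega) ?_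
      · omega
      intro t ht
      refine ⟨by rw [h1, ss_j hpμ]; omega, ?_⟩
      unfold PrecN
      rw [hy]
      rcases xx_cases p a q haq i with h | h | h | h | h <;> first | omega | skip
      all_goals
        rcases xx_cases p a q haq t with h' | h' | h' | h' | h' <;> first | omega | skip
      all_goals
        simp only [h, h'] <;> norm_num [abs_of_nonneg] <;> omega
    · -- facility j + 1
      have hns : ss k j w p q α μ β i ≠ j + 1 := by rw [hgv]; omega
      rw [Ne, ss_j1 hpμ] at hns
      unfold Overflow at hov
      have hr : p ≤ k * j + α ∧ (q - p - μ) + β = k ∧ q + 1 + k * w + β ≤ n := by omega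
      left
      have := cnt_lower (n := n) (k := k) (p := p) (q := q) (a := a) (α := α) (μ := μ) (β := β) f i
        (p + μ + 1) (q + 1) (q + 1 + k * w) (q + 1 + k * w + β) (by omega) (by omega) (by omega) ?_
      · omega
      intro t ht
      refine ⟨by rw [h1, ss_j1 hpμ]; omega, ?_⟩
      unfold PrecN
      rw [hy]
      rcases xx_cases p a q haq i with h | h | h | h | h <;> first | omega | skip
      all_goals
        rcases xx_cases p a q haq t with h' | h' | h' | h' | h' <;> first | omega | skip
      all_goals
        simp only [h, h'] <;> norm_num [abs_of_nonneg] <;> omega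
    · rcases lt_or_ge (i : ℕ) p with hip | hip
      · right; left
        rw [hX, hY, hy]
        rcases xx_cases p a q haq i with h | h | h | h | h <;> first | omega | skip
        rw [h.2]; norm_num
      · left
        apply hrf h1 i
        unfold Overflow at hov; omega
  · have hsv := hserv hov
    unfold Overflow at hov
    rcases yy_cases j g with ⟨h1, hy⟩ | ⟨h1, hy⟩ | ⟨h1, hy⟩ | ⟨h1, hy⟩
    · obtain ⟨g1, g2, g3⟩ := (ss_left _ _ h1).1 hgv
      right; right
      refine ⟨hsv, ?_⟩
      rw [hX, hY g, hy]
      rcases xx_cases p a q haq i with h | h | h | h | h <;> first | omega | skip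
      rw [h.2]; simp
    · rw [h1] at hgv
      have hgg := (ss_j hpμ _).1 hgv
      rcases yy_cases j f with ⟨h2, hy'⟩ | ⟨h2, hy'⟩ | ⟨h2, hy'⟩ | ⟨h2, hy'⟩
      · rcases lt_or_ge (i : ℕ) p with hip | hip
        · left
          apply hlf h2 i hip
          omega
        · right; right
          refine ⟨hsv, ?_⟩
          rw [hX, hY g, hY f, hy, hy']
          rcases xx_cases p a q haq i with h | h | h | h | h <;> first | omega | skip
          all_goals
            simp only [h] <;> norm_num [abs_of_nonneg]
      · omega
      all_goals
        right; right
        refine ⟨hsv, ?_⟩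
        rw [hX, hY g, hY f, hy, hy']
        rcases xx_cases p a q haq i with h | h | h | h | h <;> first | omega | skip
        all_goals
          simp only [h] <;> norm_num [abs_of_nonneg]
    · rw [h1] at hgv
      have hgg := (ss_j1 hpμ _).1 hgv
      rcases yy_cases j f with ⟨h2, hy'⟩ | ⟨h2, hy'⟩ | ⟨h2, hy'⟩ | ⟨h2, hy'⟩
      · right; right
        refine ⟨hsv, ?_⟩
        rw [hX, hY g, hY f, hy, hy']
        rcases xx_cases p a q haq i with h | h | h | h | h <;> first | omega | skip
        all_goals
          simp only [h] <;> norm_num [abs_of_nonneg]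
      · right; right
        refine ⟨hsv, ?_⟩
        rw [hX, hY g, hY f, hy, hy']
        rcases xx_cases p a q haq i with h | h | h | h | h <;> first | omega | skip
        all_goals
          simp only [h] <;> norm_num [abs_of_nonneg]
      · omega
      · rcases le_or_gt (q + 1) (i : ℕ) with hip | hip
        · left
          apply hrf h2 i
          omega
        · right; right
          refine ⟨hsv, ?_⟩
          rw [hX, hY g, hY f, hy, hy']
          rcases xx_cases p a q haq i with h | h | h | h | h <;> first | omega | skip
          all_goals
            simp only [h] <;> norm_num [abs_of_nonneg]
    · obtain ⟨g1, g2, g3⟩ := (ss_right (by omega) _ _ h1).1 hgv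
      right; right
      refine ⟨hsv, ?_⟩
      rw [hX, hY g, hy]
      rcases xx_cases p a q haq i with h | h | h | h | h <;> first | omega | skip
      rw [h.2]; simp

theorem swap_cnt {n m : ℕ} {x : Fin n → ℝ} {y : Fin m → ℝ} {s s' : Fin n → Fin m} {c o : Fin n}
    (hss : ∀ i, s' i = s (Equiv.swap c o i)) (f : Fin m) (i : Fin n)
    (hc : Prec x (y f) c i) (ho : Prec x (y f) o i) : cnt x y s' f i = cnt x y s f i := by
  unfold cnt
  have : {i' | s' i' = f ∧ Prec x (y f) i' i} =
      (Equiv.swap c o) '' {i' | s i' = f ∧ Prec x (y f) i' i} := by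
    rw [Equiv.image_eq_preimage_symm]
    ext t
    simp only [Equiv.symm_swap, Set.mem_preimage, Set.mem_ofPred_eq]
    rw [hss t]
    refine and_congr_right fun _ => ?_
    rcases eq_or_ne t c with rfl | h1
    · simp [hc, ho]
    · rcases eq_or_ne t o with rfl | h2
      · simp [hc, ho]
      · rw [Equiv.swap_apply_of_ne_of_ne h1 h2]
  rw [this, Set.ncard_image_of_injective _ (Equiv.injective _)]

theorem SW_ne_of_swap {n m k : ℕ} {x : Fin n → ℝ} {y : Fin m → ℝ} {s s' : Fin n → Fin m} {c o : Fin n}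
    (hss : ∀ i, s' i = s (Equiv.swap c o i))
    (hc : utility x y (fun _ => k) s c = utility x y (fun _ => k) s' c)
    (ho : utility x y (fun _ => k) s o ≠ utility x y (fun _ => k) s' o)
    (h : ∀ i, i ≠ c → i ≠ o → (cnt x y s (s i) i < k ∧ cnt x y s' (s' i) i < k) ∨
      (Prec x (y (s i)) c i ∧ Prec x (y (s i)) o i)) :
    SW x y (fun _ => k) s ≠ SW x y (fun _ => k) s' := by
  intro hSW
  have h1 : ∑ i, (utility x y (fun _ => k) s i - utility x y (fun _ => k) s' i) = 0 := by
    rw [Finset.sum_sub_distrib]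
    unfold SW at hSW
    linarith
  rw [Finset.sum_eq_single o] at h1
  · exact ho (by linarith)
  · intro i _ hio
    rcases eq_or_ne i c with rfl | hic
    · linarith
    · have hs : s' i = s i := by rw [hss, Equiv.swap_apply_of_ne_of_ne hic hio]
      rw [utility_eq, utility_eq]
      rcases h i hic hio with ⟨h2, h3⟩ | ⟨h2, h3⟩
      · rw [if_pos h2, if_pos h3, hs]; ring
      · rw [hs, swap_cnt hss _ _ h2 h3]; ring
  · simp

theorem utility_served {n m k : ℕ} {x : Fin n → ℝ} {y : Fin m → ℝ} {s : Fin n → Fin m} {i : Fin n}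
    (h : cnt x y s (s i) i < k) :
    utility x y (fun _ => k) s i = 1 - |x i - y (s i)| := by
  rw [utility_eq, if_pos h]

theorem xx_left {p a q i : ℕ} (h : i < p) : xx p a q i = 0 := by
  unfold xx; rw [if_pos h]

theorem xx_c {p a q : ℕ} : xx p a q (p + a + 1) = 3 / 10 := by
  unfold xx; rw [if_neg (by omega), if_neg (by omega), if_pos rfl]

theorem xx_right {p a q i : ℕ} (h : p + a + 2 ≤ q) (hi : q < i) : xx p a q i = 1 := by
  unfold xx
  rw [if_neg (by omega), if_neg (by omega), if_neg (by omega), if_neg (by omega)]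

theorem yy_j {j : ℕ} : yy j j = 1 / 5 := by
  unfold yy; simp

theorem yy_j1 {j : ℕ} : yy j (j + 1) = 2 / 5 := by
  unfold yy; simp

/-- First case: the contested outsider is on the left. -/
theorem case_left {n k j w p q a A : ℕ} (hk : 0 < k) (hq : q < n) (haq : p + a + 2 ≤ q)
    (hA : a + 2 ≤ k) (hB : q + 1 ≤ p + a + 1 + k)
    (hAk : A + a + 1 = k) (hAp : k * j + A ≤ p) :
    ∃ s s', isNE (XX n p a q) (YY j w) (fun _ => k) s ∧ isNE (XX n p a q) (YY j w) (fun _ => k) s' ∧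
      SW (XX n p a q) (YY j w) (fun _ => k) s ≠ SW (XX n p a q) (YY j w) (fun _ => k) s' := by
  have H1 : Reg n k j w p q a A a n := ⟨hk, hq, haq, hA, hB, Or.inl rfl, Or.inl ⟨by omega, hAp, by omega⟩⟩
  have H2 : Reg n k j w p q a (A - 1) (a + 1) n :=
    ⟨hk, hq, haq, hA, hB, Or.inr rfl, Or.inl ⟨by omega, by omega, by omega⟩⟩
  refine ⟨_, _, SS_isNE H1, SS_isNE H2, ?_⟩
  have hserv1 := served_of_not_overflow H1
  have hserv2 := served_of_not_overflow H2
  obtain ⟨c, hc⟩ : ∃ c : Fin n, (c : ℕ) = p + a + 1 := ⟨⟨p + a + 1, by omega⟩, rfl⟩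
  obtain ⟨o, ho⟩ : ∃ o : Fin n, (o : ℕ) = k * j + A - 1 := ⟨⟨k * j + A - 1, by omega⟩, rfl⟩
  set s := SS n k j w p q A a n with hs
  set s' := SS n k j w p q (A - 1) (a + 1) n with hs'
  have sc : (s c : ℕ) = j + 1 := (ss_j1 (by omega) _).2 (by omega)
  have so : (s o : ℕ) = j := (ss_j (by omega) _).2 (by omega)
  have sc' : (s' c : ℕ) = j := (ss_j (by omega) _).2 (by omega)
  have so' : (s' o : ℕ) = j + 1 := (ss_j1 (by omega) _).2 (by omega)
  have hX : ∀ i, XX n p a q i = xx p a q i := fun _ => rfl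
  have hY : ∀ f, YY j w f = yy j f := fun _ => rfl
  refine SW_ne_of_swap (c := c) (o := o) ?_ ?_ ?_ ?_
  · intro i
    apply Fin.ext
    rcases eq_or_ne i c with rfl | hic
    · rw [Equiv.swap_apply_left, so, sc']
    · rcases eq_or_ne i o with rfl | hio
      · rw [Equiv.swap_apply_right, sc, so']
      · rw [Equiv.swap_apply_of_ne_of_ne hic hio]
        have h1 : (i : ℕ) ≠ c := fun h => hic (Fin.ext h)
        have h2 : (i : ℕ) ≠ o := fun h => hio (Fin.ext h)
        rw [hc] at h1
        rw [ho] at h2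
        change ss _ _ _ _ _ _ _ _ (i : ℕ) = ss _ _ _ _ _ _ _ _ (i : ℕ)
        unfold ss
        generalize ((i : ℕ) - (q + 1)) / k = D
        split_ifs <;> omega
  · rw [utility_served (hserv1 c (by unfold Overflow; omega)),
      utility_served (hserv2 c (by unfold Overflow; omega)), hX, hY, hY, sc, sc', hc, xx_c, yy_j, yy_j1]
    norm_num [abs_of_nonneg]
  · have hcnt : cnt (XX n p a q) (YY j w) s' (s' o) o < k := by
      refine lt_of_le_of_lt (cnt_upper (s' o) o (p + a + 2) (q + 1) 0 0 ?_) (by omega)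
      intro t ht hprec
      rw [so'] at ht hprec
      rw [ss_j1 (by omega)] at ht
      unfold PrecN at hprec
      rw [yy_j1, xx_left (i := (o : ℕ)) (by omega)] at hprec
      rcases xx_cases p a q haq t with h' | h' | h' | h' | h' <;> simp only [h'] at hprec <;>
        norm_num [abs_of_nonneg] at hprec <;> omega
    rw [utility_served (hserv1 o (by unfold Overflow; omega)),
      utility_served hcnt, hX, hY, hY, so, so', xx_left (by omega), yy_j, yy_j1]
    norm_num [abs_of_nonneg]
  · intro i hic hio
    have h1 : (i : ℕ) ≠ c := fun h => hic (Fin.ext h)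
    have h2 : (i : ℕ) ≠ o := fun h => hio (Fin.ext h)
    have hin := i.2
    by_cases hov : Overflow n k j w p q A n i
    · right
      unfold Overflow at hov
      have si : (s i : ℕ) = j + 1 := (ss_j1 (by omega) _).2 (by omega)
      unfold Prec
      rw [hX, hX, hX, hY, si, hc, xx_c, yy_j1, xx_left (i := (o : ℕ)) (by omega)]
      rcases lt_or_ge (i : ℕ) p with hip | hip
      · rw [xx_left hip]
        refine ⟨Or.inl (by norm_num [abs_of_nonneg]), Or.inr ⟨rfl, ?_⟩⟩
        rw [Fin.lt_def]; omega
      · rw [xx_right haq (by omega)]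
        norm_num [abs_of_nonneg]
    · left
      refine ⟨hserv1 i hov, hserv2 i ?_⟩
      unfold Overflow at hov ⊢
      omega

/-- Second case: the contested outsider is on the right. -/
theorem case_right {n k j w p q a B : ℕ} (hk : 0 < k) (hq : q < n) (haq : p + a + 2 ≤ q)
    (hA : a + 2 ≤ k) (hB : q + 1 ≤ p + a + 1 + k)
    (hBk : q + B = p + a + 1 + k) (hAp : p + a + 2 ≤ k * j + k) (hw : q + 1 + k * w + B < n) :
    ∃ s s', isNE (XX n p a q) (YY j w) (fun _ => k) s ∧ isNE (XX n p a q) (YY j w) (fun _ => k) s' ∧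
      SW (XX n p a q) (YY j w) (fun _ => k) s ≠ SW (XX n p a q) (YY j w) (fun _ => k) s' := by
  have H1 : Reg n k j w p q a p a (B - 1) :=
    ⟨hk, hq, haq, hA, hB, Or.inl rfl, Or.inr ⟨by omega, by omega, by omega, by omega, by omega⟩⟩
  have H2 : Reg n k j w p q a p (a + 1) B :=
    ⟨hk, hq, haq, hA, hB, Or.inr rfl, Or.inr ⟨by omega, by omega, by omega, by omega, by omega⟩⟩
  refine ⟨_, _, SS_isNE H1, SS_isNE H2, ?_⟩
  have hserv1 := served_of_not_overflow H1
  have hserv2 := served_of_not_overflow H2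
  obtain ⟨c, hc⟩ : ∃ c : Fin n, (c : ℕ) = p + a + 1 := ⟨⟨p + a + 1, by omega⟩, rfl⟩
  obtain ⟨o, ho⟩ : ∃ o : Fin n, (o : ℕ) = q + 1 + k * w + B - 1 := ⟨⟨q + 1 + k * w + B - 1, by omega⟩, rfl⟩
  set s := SS n k j w p q p a (B - 1) with hs
  set s' := SS n k j w p q p (a + 1) B with hs'
  have sc : (s c : ℕ) = j + 1 := (ss_j1 (by omega) _).2 (by omega)
  have so : (s o : ℕ) = j := (ss_j (by omega) _).2 (by omega)
  have sc' : (s' c : ℕ) = j := (ss_j (by omega) _).2 (by omega)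
  have so' : (s' o : ℕ) = j + 1 := (ss_j1 (by omega) _).2 (by omega)
  have hX : ∀ i, XX n p a q i = xx p a q i := fun _ => rfl
  have hY : ∀ f, YY j w f = yy j f := fun _ => rfl
  refine SW_ne_of_swap (c := c) (o := o) ?_ ?_ ?_ ?_
  · intro i
    apply Fin.ext
    rcases eq_or_ne i c with rfl | hic
    · rw [Equiv.swap_apply_left, so, sc']
    · rcases eq_or_ne i o with rfl | hio
      · rw [Equiv.swap_apply_right, sc, so']
      · rw [Equiv.swap_apply_of_ne_of_ne hic hio]
        have h1 : (i : ℕ) ≠ c := fun h => hic (Fin.ext h)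
        have h2 : (i : ℕ) ≠ o := fun h => hio (Fin.ext h)
        rw [hc] at h1
        rw [ho] at h2
        change ss _ _ _ _ _ _ _ _ (i : ℕ) = ss _ _ _ _ _ _ _ _ (i : ℕ)
        unfold ss
        generalize ((i : ℕ) - (q + 1)) / k = D
        split_ifs <;> omega
  · rw [utility_served (hserv1 c (by unfold Overflow; omega)),
      utility_served (hserv2 c (by unfold Overflow; omega)), hX, hY, hY, sc, sc', hc, xx_c, yy_j, yy_j1]
    norm_num [abs_of_nonneg]
  · have hcnt : cnt (XX n p a q) (YY j w) s (s o) o < k := by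
      refine lt_of_le_of_lt (cnt_upper (s o) o (k * j) p p (p + a + 1) ?_) (by omega)
      intro t ht hprec
      rw [so] at ht hprec
      rw [ss_j (by omega)] at ht
      unfold PrecN at hprec
      rw [yy_j, xx_right (i := (o : ℕ)) haq (by omega)] at hprec
      rcases xx_cases p a q haq t with h' | h' | h' | h' | h' <;> simp only [h'] at hprec <;>
        norm_num [abs_of_nonneg] at hprec <;> omega
    rw [utility_served (hserv2 o (by unfold Overflow; omega)),
      utility_served hcnt, hX, hY, hY, so, so', xx_right haq (by omega), yy_j, yy_j1]
    norm_num [abs_of_nonneg]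
  · intro i hic hio
    have h1 : (i : ℕ) ≠ c := fun h => hic (Fin.ext h)
    have h2 : (i : ℕ) ≠ o := fun h => hio (Fin.ext h)
    have hin := i.2
    by_cases hov : Overflow n k j w p q p (B - 1) i
    · right
      unfold Overflow at hov
      have si : (s i : ℕ) = j := (ss_j (by omega) _).2 (by omega)
      unfold Prec
      rw [hX, hX, hX, hY, si, hc, xx_c, yy_j, xx_right (i := (o : ℕ)) haq (by omega),
        xx_right (i := (i : ℕ)) haq (by omega)]
      refine ⟨Or.inl (by norm_num [abs_of_nonneg]), Or.inr ⟨rfl, ?_⟩⟩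
      rw [Fin.lt_def]; omega
    · left
      refine ⟨hserv1 i hov, hserv2 i ?_⟩
      unfold Overflow at hov ⊢
      omega

theorem XX_mono {n p a q : ℕ} (haq : p + a + 2 ≤ q) : Monotone (XX n p a q) := by
  intro i i' hii
  have hii : (i : ℕ) ≤ i' := hii
  unfold XX
  rcases xx_cases p a q haq i with h | h | h | h | h <;>
    rcases xx_cases p a q haq i' with h' | h' | h' | h' | h' <;>
    first
    | omega
    | (simp only [h, h']; norm_num)

theorem XX_unit {n p a q : ℕ} (haq : p + a + 2 ≤ q) : InUnit (XX n p a q) := by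
  intro i
  unfold XX
  rcases xx_cases p a q haq i with h | h | h | h | h <;> simp only [h] <;> norm_num

/-- The combinatorial core of necessity. -/
theorem exists_two_NE {n k j w p q : ℕ} (hq : q < n) (hgap : p + 2 ≤ q)
    (hbad : q + 2 ≤ p + 2 * k) (hn : (j + 2 + w) * k < n) :
    ∃ a, p + a + 2 ≤ q ∧ ∃ s s', isNE (XX n p a q) (YY j w) (fun _ => k) s ∧
      isNE (XX n p a q) (YY j w) (fun _ => k) s' ∧
      SW (XX n p a q) (YY j w) (fun _ => k) s ≠ SW (XX n p a q) (YY j w) (fun _ => k) s' := by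
  have hn' : k * j + 2 * k + k * w < n := by
    have : (j + 2 + w) * k = k * j + 2 * k + k * w := by ring
    omega
  obtain ⟨a, ha1, ha2, ha3⟩ : ∃ a, p + a + 2 ≤ q ∧ a + 2 ≤ k ∧ q + 1 ≤ p + a + 1 + k := by
    rcases le_total k (q - p) with h | h
    · exact ⟨k - 2, by omega, by omega, by omega⟩
    · exact ⟨q - p - 2, by omega, by omega, by omega⟩
  refine ⟨a, ha1, ?_⟩
  rcases le_or_gt (k * j + (k - 1 - a)) p with h | h
  · exact case_left (A := k - 1 - a) (by omega) hq ha1 ha2 ha3 (by omega) h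
  · exact case_right (B := p + a + 1 + k - q) (by omega) hq ha1 ha2 ha3 (by omega) (by omega) (by omega)

theorem percentile_ES_iff_m_facilities (n m k : ℕ) (hk : 0 < k) (hm : 0 < m)
    (hmn : m * k < n)
    (v : Fin m → ℝ) (hv : ∀ j, v j ∈ Set.Icc (0 : ℝ) 1) (hmono : StrictMono v)
    (hgap : ∀ (j : ℕ) (hj : j + 1 < m),
      (1 : ℤ) < ⌊((n : ℝ) - 1) * v ⟨j + 1, hj⟩⌋ -
        ⌊((n : ℝ) - 1) * v ⟨j, Nat.lt_of_succ_lt hj⟩⌋) :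
    EquilibriumStable (n := n) (fun _ : Fin m => k) (PM v) ↔
      ∀ (j : ℕ) (hj : j + 1 < m),
        2 * (k : ℤ) - 1 ≤ ⌊((n : ℝ) - 1) * v ⟨j + 1, hj⟩⌋ -
          ⌊((n : ℝ) - 1) * v ⟨j, Nat.lt_of_succ_lt hj⟩⌋ := by
  have hn1 : 1 ≤ n := by omega
  have hn1' : (1 : ℝ) ≤ n := by exact_mod_cast hn1
  set P : Fin m → ℕ := fun j => ⌊((n : ℝ) - 1) * v j⌋.toNat with hP
  have hPz : ∀ j, (P j : ℤ) = ⌊((n : ℝ) - 1) * v j⌋ := by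
    intro j
    apply Int.toNat_of_nonneg
    apply Int.floor_nonneg.2
    exact mul_nonneg (by linarith) (hv j).1
  have hPn : ∀ j, P j < n := by
    intro j
    have h1 : (⌊((n : ℝ) - 1) * v j⌋ : ℝ) ≤ ((n : ℝ) - 1) * v j := Int.floor_le _
    have h2 : ((n : ℝ) - 1) * v j ≤ (n : ℝ) - 1 :=
      mul_le_of_le_one_right (by linarith) (hv j).2
    rw [← hPz] at h1
    have h3 : ((P j : ℤ) : ℝ) < (n : ℝ) := by linarith
    exact_mod_cast h3
  have hy : ∀ (x : Fin n → ℝ) (j : Fin m), PM v x j = x (Tuple.sort x ⟨P j, hPn j⟩) := by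
    intro x j
    change sortedVal x (P j) = _
    unfold sortedVal
    rw [dif_pos (hPn j)]
  simp only [← hPz] at hgap ⊢
  -- chaining gaps
  have chain : ∀ g : ℕ, (∀ (j : ℕ) (hj : j + 1 < m),
      P ⟨j, Nat.lt_of_succ_lt hj⟩ + g ≤ P ⟨j + 1, hj⟩) →
      ∀ j j' : Fin m, j < j' → P j + g ≤ P j' := by
    intro g hg j j' hlt
    obtain ⟨j, hj⟩ := j
    obtain ⟨j', hj'⟩ := j'
    have hlt : j < j' := hlt
    induction j' with
    | zero => omega
    | succ t ih =>
      have h1 := hg t hj'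
      rcases Nat.lt_or_ge j t with h | h
      · have := ih (by omega) h
        omega
      · have : j = t := by omega
        subst this
        exact h1
  constructor
  · intro hES
    by_contra hcon
    push Not at hcon
    obtain ⟨j, hj, hbad⟩ := hcon
    obtain ⟨w, rfl⟩ : ∃ w, m = j + 2 + w := ⟨m - (j + 2), by omega⟩
    have hg2 := chain 2 (by intro t ht; have := hgap t ht; omega)
    have hgj := hgap j hj
    set p := P ⟨j, Nat.lt_of_succ_lt hj⟩ with hp
    set q := P ⟨j + 1, hj⟩ with hqdef
    obtain ⟨a, haq, s, s', hs, hs', hne⟩ := exists_two_NE (n := n) (k := k) (j := j) (w := w)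
      (p := p) (q := q) (hPn _) (by omega) (by omega) hmn
    have hM : PM v (XX n p a q) = YY j w := by
      funext f
      rw [hy]
      have hsort : XX n p a q (Tuple.sort (XX n p a q) ⟨P f, hPn f⟩) = XX n p a q ⟨P f, hPn f⟩ :=
        congrFun (Tuple.unique_monotone (σ := Tuple.sort (XX n p a q)) (τ := 1)
          (Tuple.monotone_sort _) (XX_mono haq)) ⟨P f, hPn f⟩
      rw [hsort]
      change xx p a q (P f) = yy j f
      rcases yy_cases j f with ⟨h1, h2⟩ | ⟨h1, h2⟩ | ⟨h1, h2⟩ | ⟨h1, h2⟩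
      · rw [h2]
        have : P f + 2 ≤ p := hg2 f ⟨j, Nat.lt_of_succ_lt hj⟩ h1
        exact xx_left (by omega)
      · rw [h2]
        have : P f = p := congrArg P (Fin.ext h1)
        rw [this]
        unfold xx; simp
      · rw [h2]
        have : P f = q := congrArg P (Fin.ext h1)
        rw [this]
        unfold xx
        rw [if_neg (by omega), if_neg (by omega), if_neg (by omega), if_pos le_rfl]
      · rw [h2]
        have : q + 2 ≤ P f := hg2 ⟨j + 1, hj⟩ f h1
        exact xx_right haq (by omega)
    apply hne
    have := hES (XX n p a q) (XX_unit haq) s s' (by rw [hM]; exact hs) (by rw [hM]; exact hs')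
    rw [hM] at this
    exact this
  · intro hG x hx s s' hs hs'
    refine SW_eq_of_ne hk hx P hPn (chain _ ?_) (hy x) s s' hs hs'
    intro j hj
    have := hG j hj
    omega
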